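/- Let Ω ⊆ ℂⁿ be a bounded domain and let ψ: [-∞, +∞] → [0, +∞] be any function with ψ(+∞) = +∞ and lim_{t→∞} ψ(t)/t = +∞. If u is any function on Ω such that ψ∘u admits a plurisuperharmonic majorant on Ω, then u⁺ = max{u, 0} is tame. In particular, if u is also plurisubharmonic, then u⁺ is the limit, outside a pluripolar set, of an increasing sequence of upper bounded plurisubharmonic functions on Ω. -/

import Mathlib

open Complex Polynomial Filter Set Topology

noncomputable section

/-- `u` is plurisubharmonic on `Ω ⊆ ℂⁿ`: it is upper semicontinuous on `Ω`, takes values in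
`[-∞, ∞)`, is not identically `-∞`, and on every closed disc of every complex line contained
in `Ω` it satisfies the maximum principle against real parts of complex polynomials
(an equivalent formulation of subharmonicity of the restriction to every complex line). -/
def IsPSH {n : ℕ} (Ω : Set (Fin n → ℂ)) (u : (Fin n → ℂ) → EReal) : Prop :=
  UpperSemicontinuousOn u Ω ∧
  (∀ z ∈ Ω, u z ≠ ⊤) ∧
  (∃ z ∈ Ω, u z ≠ ⊥) ∧
  ∀ z ∈ Ω, ∀ w : Fin n → ℂ, ∀ r : ℝ, 0 < r →
    (∀ ζ : ℂ, ‖ζ‖ ≤ r → z + ζ • w ∈ Ω) →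
    ∀ p : Polynomial ℂ,
      (∀ ζ : ℂ, ‖ζ‖ = r → u (z + ζ • w) ≤ (((p.eval ζ).re : ℝ) : EReal)) →
      ∀ ζ : ℂ, ‖ζ‖ ≤ r → u (z + ζ • w) ≤ (((p.eval ζ).re : ℝ) : EReal)

/-- `v` is plurisuperharmonic on `Ω` iff `-v` is plurisubharmonic on `Ω`. -/
def IsPSupH {n : ℕ} (Ω : Set (Fin n → ℂ)) (v : (Fin n → ℂ) → EReal) : Prop :=
  IsPSH Ω (fun z => -(v z))

/-- `f` belongs to the class `ℳ`: `f : Ω → [0, +∞]` admits a plurisuperharmonic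
majorant on `Ω`. -/
def MemM {n : ℕ} (Ω : Set (Fin n → ℂ)) (f : (Fin n → ℂ) → EReal) : Prop :=
  (∀ z ∈ Ω, 0 ≤ f z) ∧ ∃ v, IsPSupH Ω v ∧ ∀ z ∈ Ω, f z ≤ v z

/-- The reduced function `R_λ f`: the pointwise infimum of all plurisuperharmonic
majorants of `(f - λ)⁺ = max {f - λ, 0}` on `Ω`. -/
def Rop {n : ℕ} (Ω : Set (Fin n → ℂ)) (f : (Fin n → ℂ) → EReal) (lam : ℝ)
    (z : Fin n → ℂ) : EReal :=
  sInf { y | ∃ v, IsPSupH Ω v ∧ (∀ ζ ∈ Ω, max (f ζ - (lam : EReal)) 0 ≤ v ζ) ∧ y = v z }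

/-- Lower semicontinuous regularization of `g` relative to the set `A`:
`g_*(z) = liminf_{A ∋ ζ → z} g(ζ)`. -/
def lscReg {n : ℕ} (A : Set (Fin n → ℂ)) (g : (Fin n → ℂ) → EReal)
    (z : Fin n → ℂ) : EReal :=
  liminf g (nhdsWithin z A)

/-- Upper semicontinuous regularization of `g` relative to the set `A`:
`g*(z) = limsup_{A ∋ ζ → z} g(ζ)`. -/
def uscReg {n : ℕ} (A : Set (Fin n → ℂ)) (g : (Fin n → ℂ) → EReal)
    (z : Fin n → ℂ) : EReal :=
  limsup g (nhdsWithin z A)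

/-- `S_λ f`: the lower semicontinuous regularization of `R_λ f` on `Ω`. -/
def Slam {n : ℕ} (Ω : Set (Fin n → ℂ)) (f : (Fin n → ℂ) → EReal) (lam : ℝ) :
    (Fin n → ℂ) → EReal :=
  lscReg Ω (Rop Ω f lam)

/-- The operator `S`: the lower semicontinuous regularization of
`lim_{λ → ∞} S_λ f`; since `λ ↦ S_λ f` is decreasing on `λ ≥ 0`, this limit is the
infimum over `λ ≥ 0`. -/
def Sop {n : ℕ} (Ω : Set (Fin n → ℂ)) (f : (Fin n → ℂ) → EReal) :
    (Fin n → ℂ) → EReal :=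
  lscReg Ω (fun z => ⨅ (lam : ℝ) (_ : 0 ≤ lam), Slam Ω f lam z)

/-- `f` is tame on `Ω` if `S f ≡ 0`. -/
def Tame {n : ℕ} (Ω : Set (Fin n → ℂ)) (f : (Fin n → ℂ) → EReal) : Prop :=
  ∀ z ∈ Ω, Sop Ω f z = 0

/-- `E` is a pluripolar subset of `Ω`: `E ⊆ {w = -∞}` for some plurisubharmonic `w` on `Ω`. -/
def Pluripolar {n : ℕ} (Ω : Set (Fin n → ℂ)) (E : Set (Fin n → ℂ)) : Prop :=
  E ⊆ Ω ∧ ∃ w, IsPSH Ω w ∧ ∀ z ∈ E, w z = ⊥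

/-- Every element of the span of the Fourier monomials agrees, up to real parts, with a complex
polynomial on the unit circle. -/
theorem exists_poly_re_eq_of_mem_span_fourier {g : C(AddCircle (1 : ℝ), ℂ)}
    (hg : g ∈ Submodule.span ℂ (range (@fourier (1 : ℝ)))) (c : ℂ) :
    ∃ p : ℂ[X], ∀ θ, (p.eval (AddCircle.toCircle θ : ℂ)).re = (c * g θ).re := by
  induction hg using Submodule.span_induction generalizing c with
  | mem x hx =>
    obtain ⟨k, rfl⟩ := hx
    obtain ⟨m, rfl | rfl⟩ := k.eq_nat_or_neg
    · refine ⟨C c * X ^ m, fun θ => ?_⟩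
      simp [AddCircle.toCircle_nsmul]
    · refine ⟨C (starRingEnd ℂ c) * X ^ m, fun θ => ?_⟩
      rw [← Complex.conj_re]
      simp [AddCircle.toCircle_nsmul, AddCircle.toCircle_neg, ← Circle.coe_inv_eq_conj]
  | zero => exact ⟨0, fun θ => by simp⟩
  | add x y _ _ hx hy =>
    obtain ⟨p, hp⟩ := hx c
    obtain ⟨q, hq⟩ := hy c
    exact ⟨p + q, fun θ => by simp [hp, hq, mul_add]⟩
  | smul a x _ hx =>
    obtain ⟨p, hp⟩ := hx (c * a)
    exact ⟨p, fun θ => by simp [hp, mul_assoc]⟩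

/-- Real parts of complex polynomials are uniformly dense in the continuous real functions on a
circle. -/
theorem exists_poly_re_near {r : ℝ} (hr : 0 < r) (φ : C(Metric.sphere (0 : ℂ) r, ℝ))
    {ε : ℝ} (hε : 0 < ε) :
    ∃ p : ℂ[X], ∀ x : Metric.sphere (0 : ℂ) r, |(p.eval (x : ℂ)).re - φ x| < ε := by
  let j : AddCircle (1 : ℝ) → Metric.sphere (0 : ℂ) r := fun θ =>
    ⟨r * (AddCircle.toCircle θ : ℂ), by simp [abs_of_pos hr, Circle.norm_coe]⟩
  have hj : Continuous j := by
    refine Continuous.subtype_mk ?_ _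
    exact continuous_const.mul (continuous_subtype_val.comp AddCircle.continuous_toCircle)
  let g : C(AddCircle (1 : ℝ), ℂ) := ⟨fun θ => (φ (j θ) : ℂ), by fun_prop⟩
  have hg : g ∈ (Submodule.span ℂ (range (@fourier (1 : ℝ)))).topologicalClosure := by
    have : Fact ((0 : ℝ) < 1) := ⟨one_pos⟩
    rw [span_fourier_closure_eq_top]; trivial
  obtain ⟨h, hh, hgh⟩ := Metric.mem_closure_iff.1 hg ε hε
  obtain ⟨p, hp⟩ := exists_poly_re_eq_of_mem_span_fourier hh 1
  refine ⟨p.comp (C ((r : ℂ)⁻¹) * X), fun x => ?_⟩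
  have hr' : (r : ℂ) ≠ 0 := by exact_mod_cast hr.ne'
  have hx : ‖(x : ℂ)‖ = r := by simp
  obtain ⟨θ, hθ⟩ := (AddCircle.homeomorphCircle (one_ne_zero (α := ℝ))).surjective
    ⟨(r : ℂ)⁻¹ * x, by simp [Submonoid.unitSphere, hx, abs_of_pos hr, hr.ne']⟩
  rw [AddCircle.homeomorphCircle_apply] at hθ
  have hθ' : (AddCircle.toCircle θ : ℂ) = (r : ℂ)⁻¹ * x := congrArg Subtype.val hθ
  have hjx : j θ = x := by
    ext; simp [j, hθ', hr']
  have h1 : (p.comp (C ((r : ℂ)⁻¹) * X)).eval (x : ℂ)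
      = p.eval (AddCircle.toCircle θ : ℂ) := by simp [hθ']
  rw [h1, hp, one_mul]
  have h2 : (g θ).re = φ x := by simp [g, hjx]
  rw [← h2, ← Complex.sub_re]
  refine (Complex.abs_re_le_norm _).trans_lt ?_
  have := (ContinuousMap.dist_lt_iff hε).1 hgh θ
  rwa [dist_comm, dist_eq_norm] at this

/-- If the real part of a polynomial is nonnegative on a circle, it is nonnegative on the disc. -/
theorem poly_re_nonneg_of_sphere {r : ℝ} (hr : 0 < r) (p : ℂ[X])
    (h : ∀ ζ : ℂ, ‖ζ‖ = r → 0 ≤ (p.eval ζ).re) (ζ : ℂ) (hζ : ‖ζ‖ ≤ r) :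
    0 ≤ (p.eval ζ).re := by
  have := Complex.norm_le_of_forall_mem_frontier_norm_le (f := fun z => Complex.exp (-p.eval z))
    (U := Metric.ball (0 : ℂ) r) Metric.isBounded_ball
    (Differentiable.diffContOnCl (by fun_prop)) (C := 1) (fun z hz => by
      rw [frontier_ball _ hr.ne'] at hz
      have := h z (by simpa using hz)
      simp [Complex.norm_exp, this]) (z := ζ)
    (by rw [closure_ball _ hr.ne']; simpa using hζ)
  simpa [Complex.norm_exp] using this

/-- The maximum principle on the closed disc of radius `r` against real parts of polynomials. -/
structure DiscMax (r : ℝ) (f : ℂ → EReal) : Prop where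
  usc : UpperSemicontinuousOn f (Metric.sphere 0 r)
  ne_top : ∀ ζ, ‖ζ‖ ≤ r → f ζ ≠ ⊤
  le : ∀ p : ℂ[X], (∀ ζ : ℂ, ‖ζ‖ = r → f ζ ≤ (((p.eval ζ).re : ℝ) : EReal)) →
    ∀ ζ : ℂ, ‖ζ‖ ≤ r → f ζ ≤ (((p.eval ζ).re : ℝ) : EReal)

theorem EReal.exists_real_between_of_add_le {a b : EReal} {c ε : ℝ} (ha : a ≠ ⊤) (hb : b ≠ ⊤)
    (h : a + b ≤ c) (hε : 0 < ε) : ∃ d : ℝ, a < d ∧ b < ((c + ε - d : ℝ) : EReal) := by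
  induction a with
  | top => exact absurd rfl ha
  | bot =>
    induction b with
    | top => exact absurd rfl hb
    | bot => exact ⟨0, EReal.bot_lt_coe _, EReal.bot_lt_coe _⟩
    | coe b => exact ⟨c - b, EReal.bot_lt_coe _, by norm_cast; linarith⟩
  | coe a =>
    induction b with
    | top => exact absurd rfl hb
    | bot => exact ⟨a + ε, by norm_cast; linarith, EReal.bot_lt_coe _⟩
    | coe b =>
      norm_cast at h
      exact ⟨a + ε / 2, by norm_cast; linarith, by norm_cast; linarith⟩

theorem DiscMax.add {r : ℝ} (hr : 0 < r) {f g : ℂ → EReal} (hf : DiscMax r f)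
    (hg : DiscMax r g) : DiscMax r (fun ζ => f ζ + g ζ) := by
  have key : ∀ p : ℂ[X], (∀ ζ : ℂ, ‖ζ‖ = r → f ζ + g ζ ≤ (((p.eval ζ).re : ℝ) : EReal)) →
      ∀ ε : ℝ, 0 < ε → ∀ ζ : ℂ, ‖ζ‖ ≤ r → f ζ + g ζ ≤ (((p.eval ζ).re + 3 * ε : ℝ) : EReal) := by
    intro p hp ε hε ζ hζ
    have hpc : Continuous fun x : Metric.sphere (0 : ℂ) r => (p.eval (x : ℂ)).re := by fun_prop
    have hfu := upperSemicontinuousOn_iff_restrict.2 hf.usc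
    have hgu := upperSemicontinuousOn_iff_restrict.2 hg.usc
    have hnorm : ∀ x : Metric.sphere (0 : ℂ) r, ‖(x : ℂ)‖ = r := fun x => by simp
    obtain ⟨φ, hφ⟩ := exists_continuous_forall_mem_convex_of_local_const
      (X := Metric.sphere (0 : ℂ) r) (E := ℝ)
      (t := fun x => {c : ℝ | f x < c ∧ g x < (((p.eval (x : ℂ)).re + ε - c : ℝ) : EReal)})
      (fun x => by
        apply Set.OrdConnected.convex
        refine ⟨fun a ha b hb c hc => ⟨ha.1.trans_le (by exact_mod_cast hc.1), hb.2.trans_le ?_⟩⟩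
        have := hc.2
        norm_cast
        linarith)
      (fun x => by
        obtain ⟨c, hc1, hc2⟩ := EReal.exists_real_between_of_add_le
          (hf.ne_top x (hnorm x).le) (hg.ne_top x (hnorm x).le) (hp x (hnorm x)) hε
        obtain ⟨d, hd1, hd2⟩ := EReal.lt_iff_exists_real_btwn.1 hc2
        refine ⟨c, ?_⟩
        have h3 : ∀ᶠ y : Metric.sphere (0 : ℂ) r in 𝓝 x, d < (p.eval (y : ℂ)).re + ε - c :=
          (by fun_prop : Continuous fun y : Metric.sphere (0 : ℂ) r =>
            (p.eval (y : ℂ)).re + ε - c).continuousAt.eventually_const_lt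
              (by exact_mod_cast hd2)
        filter_upwards [hfu x _ hc1, hgu x _ hd1, h3] with y h1 h2 h3
        exact ⟨h1, lt_trans h2 (by exact_mod_cast h3)⟩)
    obtain ⟨q, hq⟩ := exists_poly_re_near hr φ hε
    have h1 := hf.le (q + C (ε : ℂ)) (fun z hz => by
      refine (hφ ⟨z, by simpa using hz⟩).1.le.trans ?_
      have := abs_lt.1 (hq ⟨z, by simpa using hz⟩)
      simp only [eval_add, eval_C, add_re, ofReal_re, EReal.coe_le_coe_iff]
      linarith [this.1]) ζ hζ
    have h2 := hg.le (p - q + C ((2 * ε : ℝ) : ℂ)) (fun z hz => by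
      refine (hφ ⟨z, by simpa using hz⟩).2.le.trans ?_
      have := abs_lt.1 (hq ⟨z, by simpa using hz⟩)
      simp only [eval_add, eval_sub, eval_C, add_re, sub_re, ofReal_re, EReal.coe_le_coe_iff]
      linarith [this.2]) ζ hζ
    refine (add_le_add h1 h2).trans ?_
    norm_cast
    simp
    linarith
  refine ⟨hf.usc.add' hg.usc fun x hx => ?_, fun ζ hζ => ?_, fun p hp ζ hζ => ?_⟩
  · have hx : ‖x‖ ≤ r := by simpa using (mem_sphere_zero_iff_norm.1 hx).le
    exact EReal.continuousAt_add (Or.inl (hf.ne_top x hx)) (Or.inr (hg.ne_top x hx))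
  · exact EReal.add_ne_top (hf.ne_top ζ hζ) (hg.ne_top ζ hζ)
  · refine EReal.le_of_forall_lt_iff_le.1 fun y hy => ?_
    have hy : (p.eval ζ).re < y := by exact_mod_cast hy
    have := key p hp ((y - (p.eval ζ).re) / 3) (by linarith) ζ hζ
    convert this using 2
    ring

theorem DiscMax.sum {ι : Type*} {r : ℝ} (hr : 0 < r) (s : Finset ι) (f : ι → ℂ → EReal)
    (hf : ∀ i ∈ s, DiscMax r (f i)) : DiscMax r (fun ζ => ∑ i ∈ s, f i ζ) := by
  classical
  induction s using Finset.induction_on with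
  | empty =>
    refine ⟨by simpa using upperSemicontinuousOn_const, by simp, fun p hp ζ hζ => ?_⟩
    have := poly_re_nonneg_of_sphere hr p (fun z hz => by simpa using hp z hz) ζ hζ
    simpa using this
  | insert a s ha ih =>
    simp only [Finset.sum_insert ha]
    exact (hf a (by simp)).add hr (ih fun i hi => hf i (by simp [hi]))

theorem DiscMax.rotate {r : ℝ} {f : ℂ → EReal} (hf : DiscMax r f) {ω : ℂ} (hω : ‖ω‖ = 1) :
    DiscMax r (fun ζ => f (ω * ζ)) := by
  have hω0 : ω ≠ 0 := norm_ne_zero_iff.1 (by simp [hω])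
  refine ⟨hf.usc.comp (g := fun ζ => ω * ζ) (by fun_prop) (fun z hz => by simpa [hω] using hz),
    fun ζ hζ => hf.ne_top _ (by simpa [hω] using hζ), fun p hp ζ hζ => ?_⟩
  have := hf.le (p.comp (C ω⁻¹ * X)) (fun z hz => by
    simpa [hω0] using hp (ω⁻¹ * z) (by simp [hω, hz])) (ω * ζ) (by simpa [hω] using hζ)
  simpa [hω0] using this

/-- If `f` is `-∞` near a point of the circle, then it is `-∞` at the centre of the disc. -/
theorem DiscMax.eq_bot_of_eventually {f : ℂ → EReal} (hf : DiscMax 1 f)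
    (h : ∀ᶠ ζ in 𝓝 (1 : ℂ), f ζ = ⊥) : f 0 = ⊥ := by
  obtain ⟨δ, hδ, hb⟩ := Metric.eventually_nhds_iff.1 h
  have hK : IsCompact (Metric.sphere (0 : ℂ) 1) := isCompact_sphere 0 1
  obtain ⟨t, ht, htc⟩ := hK.elim_nhds_subcover (fun ζ => Metric.ball ζ δ)
    (fun ζ _ => Metric.ball_mem_nhds ζ hδ)
  have hn : ∀ ω ∈ t, ‖ω‖ = 1 := fun ω hω => by simpa using ht ω hω
  have hsum := DiscMax.sum one_pos t (fun ω ζ => f (ω⁻¹ * ζ))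
    (fun ω hω => hf.rotate (by simp [hn ω hω]))
  have hbot : ∀ ζ : ℂ, ‖ζ‖ = 1 → ∑ ω ∈ t, f (ω⁻¹ * ζ) = ⊥ := fun ζ hζ => by
    obtain ⟨ω, hω, hmem⟩ := mem_iUnion₂.1 (htc (show ζ ∈ Metric.sphere (0 : ℂ) 1 by simpa using hζ))
    have hω0 : ω ≠ 0 := norm_ne_zero_iff.1 (by simp [hn ω hω])
    rw [← Finset.add_sum_erase _ _ hω, hb, EReal.bot_add]
    have : ω⁻¹ * ζ - 1 = ω⁻¹ * (ζ - ω) := by field_simp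
    rw [dist_eq_norm, this, norm_mul, norm_inv, hn ω hω, inv_one, one_mul, ← dist_eq_norm]
    exact hmem
  have h0 : ∑ _ω ∈ t, f 0 = ⊥ := by
    refine eq_bot_iff.2 (EReal.le_of_forall_lt_iff_le.1 fun y _ => ?_)
    have := hsum.le (C (y : ℂ)) (fun ζ hζ => by simp [hbot ζ hζ]) 0 (by simp)
    simpa using this
  by_contra hne
  have hne' : f 0 ≠ ⊤ := hf.ne_top 0 (by simp)
  lift f 0 to ℝ using ⟨hne', hne⟩ with a
  rw [Finset.sum_const, ← EReal.coe_nsmul] at h0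
  exact EReal.coe_ne_bot _ h0

theorem IsPSH.discMax {n : ℕ} {Ω : Set (Fin n → ℂ)} {u : (Fin n → ℂ) → EReal}
    (hu : IsPSH Ω u) {z w : Fin n → ℂ} {r : ℝ} (hr : 0 < r)
    (h : ∀ ζ : ℂ, ‖ζ‖ ≤ r → z + ζ • w ∈ Ω) : DiscMax r (fun ζ => u (z + ζ • w)) := by
  have hz : z ∈ Ω := by simpa using h 0 (by simpa using hr.le)
  refine ⟨hu.1.comp (g := fun ζ : ℂ => z + ζ • w) (by fun_prop) fun ζ hζ => h ζ ?_,
    fun ζ hζ => hu.2.1 _ (h ζ hζ), hu.2.2.2 z hz w r hr h⟩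
  exact (mem_sphere_zero_iff_norm.1 hζ).le

theorem IsPSH.add {n : ℕ} {Ω : Set (Fin n → ℂ)} {u v : (Fin n → ℂ) → EReal}
    (hu : IsPSH Ω u) (hv : IsPSH Ω v) (hne : ∃ z ∈ Ω, u z ≠ ⊥ ∧ v z ≠ ⊥) :
    IsPSH Ω (fun z => u z + v z) := by
  refine ⟨hu.1.add' hv.1 fun z hz => EReal.continuousAt_add (Or.inl (hu.2.1 z hz))
    (Or.inr (hv.2.1 z hz)), fun z hz => EReal.add_ne_top (hu.2.1 z hz) (hv.2.1 z hz), ?_,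
    fun z _ w r hr h => ((hu.discMax hr h).add hr (hv.discMax hr h)).le⟩
  obtain ⟨z, hz, h1, h2⟩ := hne
  exact ⟨z, hz, by simp [EReal.add_eq_bot_iff, h1, h2]⟩

theorem IsPSH.max_zero {n : ℕ} {Ω : Set (Fin n → ℂ)} {u : (Fin n → ℂ) → EReal}
    (hu : IsPSH Ω u) : IsPSH Ω (fun z => max (u z) 0) := by
  refine ⟨hu.1.sup upperSemicontinuousOn_const, fun z hz => ?_, ?_,
    fun z hz w r hr h p hp ζ hζ => max_le ?_ ?_⟩
  · rcases max_choice (u z) 0 with h | h <;> simp [h, hu.2.1 z hz]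
  · obtain ⟨z, hz, -⟩ := hu.2.2.1
    exact ⟨z, hz, (EReal.bot_lt_zero.trans_le (le_max_right _ _)).ne'⟩
  · exact hu.2.2.2 z hz w r hr h p (fun ξ hξ => (le_max_left _ _).trans (hp ξ hξ)) ζ hζ
  · have := poly_re_nonneg_of_sphere hr p (fun ξ hξ => by
      exact_mod_cast (le_max_right _ _).trans (hp ξ hξ)) ζ hζ
    exact_mod_cast this

theorem EReal.coe_mul_le_coe_iff {ε y : ℝ} (hε : 0 < ε) (x : EReal) :
    (ε : EReal) * x ≤ y ↔ x ≤ ((ε⁻¹ * y : ℝ) : EReal) := by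
  induction x with
  | top => rw [EReal.coe_mul_top_of_pos hε]; simp [-EReal.coe_mul]
  | bot => rw [EReal.coe_mul_bot_of_pos hε]; simp
  | coe x =>
    rw [← EReal.coe_mul, EReal.coe_le_coe_iff, EReal.coe_le_coe_iff, inv_mul_eq_div,
      le_div_iff₀ hε, mul_comm]

theorem IsPSH.const_mul {n : ℕ} {Ω : Set (Fin n → ℂ)} {u : (Fin n → ℂ) → EReal}
    (hu : IsPSH Ω u) {ε : ℝ} (hε : 0 < ε) : IsPSH Ω (fun z => (ε : EReal) * u z) := by
  have hmono : Monotone fun x : EReal => (ε : EReal) * x := fun a b hab =>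
    mul_le_mul_of_nonneg_left hab (by exact_mod_cast hε.le)
  have hcont : Continuous fun x : EReal => (ε : EReal) * x :=
    continuous_iff_continuousAt.2 fun x =>
      EReal.Tendsto.const_mul tendsto_id (Or.inl (EReal.coe_ne_bot ε)) (Or.inl (EReal.coe_ne_top ε))
  refine ⟨hcont.comp_upperSemicontinuousOn hu.1 hmono, fun z hz => ?_, ?_,
    fun z hz w r hr h p hp ζ hζ => ?_⟩
  · simp [EReal.mul_eq_top, hu.2.1 z hz, hε.le]
  · obtain ⟨z, hz, hne⟩ := hu.2.2.1
    exact ⟨z, hz, by simp [EReal.mul_eq_bot, hne, hε.le]⟩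
  · have := hu.2.2.2 z hz w r hr h (C ((ε⁻¹ : ℝ) : ℂ) * p) (fun ξ hξ => by
      have := (EReal.coe_mul_le_coe_iff hε _).1 (hp ξ hξ)
      rwa [eval_mul, eval_C, Complex.re_ofReal_mul]) ζ hζ
    rw [eval_mul, eval_C, Complex.re_ofReal_mul] at this
    exact (EReal.coe_mul_le_coe_iff hε _).2 this

theorem IsPSupH.const_mul {n : ℕ} {Ω : Set (Fin n → ℂ)} {v : (Fin n → ℂ) → EReal}
    (hv : IsPSupH Ω v) {ε : ℝ} (hε : 0 < ε) : IsPSupH Ω (fun z => (ε : EReal) * v z) := by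
  have := IsPSH.const_mul hv hε
  simpa only [IsPSupH, mul_neg] using this

/-- A plurisubharmonic function on a domain is not `-∞` on any nonempty open subset. -/
theorem IsPSH.frequently_ne_bot {n : ℕ} {Ω : Set (Fin n → ℂ)} {u : (Fin n → ℂ) → EReal}
    (hΩo : IsOpen Ω) (hΩc : IsPreconnected Ω) (hu : IsPSH Ω u) {z : Fin n → ℂ} (hz : z ∈ Ω) :
    ∃ᶠ ζ in 𝓝 z, u ζ ≠ ⊥ := by
  intro hbot
  have hsub : Ω ⊆ {x | ∀ᶠ ζ in 𝓝 x, u ζ = ⊥} := by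
    refine hΩc.subset_of_closure_inter_subset isOpen_setOfPred_eventually_nhds
      ⟨z, hz, by simpa using hbot⟩ ?_
    rintro b ⟨hb, hbΩ⟩
    obtain ⟨R, hR, hball⟩ := Metric.isOpen_iff.1 hΩo b hbΩ
    obtain ⟨a, ha, hab⟩ := Metric.mem_closure_iff.1 hb (R / 3) (by positivity)
    refine Metric.eventually_nhds_iff.2 ⟨R / 3, by positivity, fun y hy => ?_⟩
    have hya : ‖a - y‖ ≤ R / 3 + R / 3 := by
      rw [← dist_eq_norm, dist_comm]
      linarith [dist_triangle y b a]
    have hd := hu.discMax (z := y) (w := a - y) one_pos fun ζ hζ => hball (by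
      rw [Metric.mem_ball, dist_eq_norm]
      have h1 : ‖y - b‖ < R / 3 := by rwa [← dist_eq_norm]
      have h2 : ‖ζ • (a - y)‖ ≤ ‖a - y‖ := by
        rw [norm_smul]; exact mul_le_of_le_one_left (norm_nonneg _) hζ
      rw [add_sub_right_comm]
      linarith [norm_add_le (y - b) (ζ • (a - y))])
    have hc : Tendsto (fun ζ : ℂ => y + ζ • (a - y)) (𝓝 1) (𝓝 a) := by
      have : ContinuousAt (fun ζ : ℂ => y + ζ • (a - y)) 1 := by fun_prop
      simpa [ContinuousAt] using this
    simpa using hd.eq_bot_of_eventually (hc.eventually ha)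
  obtain ⟨x, hx, hne⟩ := hu.2.2.1
  exact hne (hsub hx).self_of_nhds

/-- Superlinear growth: `u⁺` is dominated by a constant plus an arbitrarily small multiple of any
majorant of `ψ ∘ u`. -/
theorem exists_sub_le_mul_majorant {α : Type*} {Ω : Set α} {ψ : EReal → EReal}
    (hψ0 : ∀ t, 0 ≤ ψ t) (hψtop : ψ ⊤ = ⊤)
    (hψgrow : Tendsto (fun t : ℝ => ψ (t : EReal) / (t : EReal)) atTop (𝓝 ⊤))
    {u v : α → EReal} (hv : ∀ z ∈ Ω, ψ (u z) ≤ v z) {ε : ℝ} (hε : 0 < ε) :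
    ∃ lam : ℝ, 0 ≤ lam ∧ ∀ z ∈ Ω, max (u z) 0 ≤ lam + (ε : EReal) * v z := by
  have h := (EReal.tendsto_nhds_top_iff_real.1 hψgrow ε⁻¹)
  obtain ⟨L, hL⟩ := eventually_atTop.1 h
  refine ⟨max L 1, by positivity, fun z hz => ?_⟩
  have hv0 : 0 ≤ (ε : EReal) * v z :=
    mul_nonneg (by exact_mod_cast hε.le) ((hψ0 _).trans (hv z hz))
  refine max_le ?_ (add_nonneg (by exact_mod_cast (by positivity : 0 ≤ max L 1)) hv0)
  rcases le_or_gt (u z) ((max L 1 : ℝ) : EReal) with hle | hlt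
  · exact hle.trans (le_add_of_nonneg_right hv0)
  · have hlam : (0 : EReal) ≤ ((max L 1 : ℝ) : EReal) := by
      exact_mod_cast (by positivity : 0 ≤ max L 1)
    refine le_trans ?_ (le_add_of_nonneg_left hlam)
    have hvz := hv z hz
    generalize u z = t at *
    generalize v z = s at *
    induction t with
    | bot => simp
    | top =>
      rw [hψtop, top_le_iff] at hvz
      rw [hvz, EReal.coe_mul_top_of_pos hε]
    | coe t =>
      have hlt : max L 1 < t := by exact_mod_cast hlt
      have ht : 0 < t := by linarith [le_max_right L 1]
      have h1 := hL t ((le_max_left L 1).trans hlt.le)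
      have h2 := (EReal.lt_div_iff (by exact_mod_cast ht) (EReal.coe_ne_top t)).1 h1
      have h3 := h2.le.trans hvz
      rw [← EReal.coe_mul] at h3
      induction s with
      | bot => exact absurd ((hψ0 t).trans hvz) (by simp)
      | top => rw [EReal.coe_mul_top_of_pos hε]; exact le_top
      | coe s =>
        rw [← EReal.coe_mul, EReal.coe_le_coe_iff]
        have h3 : ε⁻¹ * t ≤ s := by exact_mod_cast h3
        rwa [inv_mul_le_iff₀ hε] at h3

theorem lscReg_le_self {n : ℕ} {A : Set (Fin n → ℂ)} (g : (Fin n → ℂ) → EReal)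
    {z : Fin n → ℂ} (hz : z ∈ A) : lscReg A g z ≤ g z :=
  liminf_le_of_frequently_le
    ((frequently_pure.2 le_rfl : ∃ᶠ ζ in pure z, g ζ ≤ g z).filter_mono (pure_le_nhdsWithin hz))

theorem lscReg_nonneg {n : ℕ} {A : Set (Fin n → ℂ)} {g : (Fin n → ℂ) → EReal}
    (hg : ∀ z ∈ A, 0 ≤ g z) (z : Fin n → ℂ) : 0 ≤ lscReg A g z :=
  le_liminf_of_le (h := eventually_mem_nhdsWithin.mono hg)

theorem Rop_nonneg {n : ℕ} {Ω : Set (Fin n → ℂ)} (f : (Fin n → ℂ) → EReal) (lam : ℝ)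
    {z : Fin n → ℂ} (hz : z ∈ Ω) : 0 ≤ Rop Ω f lam z := by
  refine le_sInf ?_
  rintro y ⟨v, -, hv, rfl⟩
  exact (le_max_right _ _).trans (hv z hz)

/-- A function dominated by a constant plus an arbitrarily small multiple of a fixed nonnegative
plurisuperharmonic function is tame. -/
theorem tame_of_le_add_mul {n : ℕ} {Ω : Set (Fin n → ℂ)} (hΩo : IsOpen Ω)
    (hΩc : IsPreconnected Ω) {f v : (Fin n → ℂ) → EReal} (hv : IsPSupH Ω v)
    (hv0 : ∀ z ∈ Ω, 0 ≤ v z)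
    (h : ∀ ε : ℝ, 0 < ε → ∃ lam : ℝ, 0 ≤ lam ∧ ∀ z ∈ Ω, f z ≤ lam + (ε : EReal) * v z) :
    Tame Ω f := by
  intro z hz
  refine le_antisymm ?_ (lscReg_nonneg (fun ζ _ => le_iInf₂ fun lam _ =>
    lscReg_nonneg (fun ξ hξ => Rop_nonneg f lam hξ) ζ) z)
  have hfreq : ∃ᶠ ζ in 𝓝[Ω] z, -v ζ ≠ ⊥ := by
    rw [hΩo.nhdsWithin_eq hz]
    exact IsPSH.frequently_ne_bot hΩo hΩc hv hz
  refine liminf_le_of_frequently_le ((hfreq.and_eventually eventually_mem_nhdsWithin).mono ?_)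
  rintro ζ ⟨hne, hζ⟩
  have hle : ∀ ε : ℝ, 0 < ε → (⨅ (lam : ℝ) (_ : 0 ≤ lam), Slam Ω f lam ζ) ≤ (ε : EReal) * v ζ := by
    intro ε hε
    obtain ⟨lam, hlam, hf⟩ := h ε hε
    refine (iInf₂_le lam hlam).trans ((lscReg_le_self _ hζ).trans (sInf_le ?_))
    refine ⟨_, hv.const_mul hε, fun ξ hξ => max_le ?_ ?_, rfl⟩
    · exact EReal.sub_le_of_le_add' (hf ξ hξ)
    · exact mul_nonneg (by exact_mod_cast hε.le) (hv0 ξ hξ)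
  have hv0ζ := hv0 ζ hζ
  generalize v ζ = s at *
  induction s with
  | bot => simp at hv0ζ
  | top => simp at hne
  | coe s =>
    have hs : 0 ≤ s := by exact_mod_cast hv0ζ
    refine EReal.le_of_forall_lt_iff_le.1 fun y hy => ?_
    have hy : 0 < y := by exact_mod_cast hy
    refine (hle (y / (s + 1)) (by positivity)).trans ?_
    rw [← EReal.coe_mul, EReal.coe_le_coe_iff, div_mul_eq_mul_div, div_le_iff₀ (by positivity)]
    nlinarith

/-- A plurisubharmonic function whose positive part is dominated by a constant plus an arbitrarily
small multiple of a fixed nonnegative plurisuperharmonic function has positive part equal, off a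
pluripolar set, to an increasing limit of bounded above plurisubharmonic functions. -/
theorem IsPSH.exists_seq_tendsto_max_zero {n : ℕ} {Ω : Set (Fin n → ℂ)}
    {u v : (Fin n → ℂ) → EReal} (hu : IsPSH Ω u) (hv : IsPSupH Ω v)
    (hv0 : ∀ z ∈ Ω, 0 ≤ v z)
    (h : ∀ ε : ℝ, 0 < ε → ∃ lam : ℝ, 0 ≤ lam ∧
      ∀ z ∈ Ω, max (u z) 0 ≤ lam + (ε : EReal) * v z) :
    ∃ E : Set (Fin n → ℂ), Pluripolar Ω E ∧
      ∃ w : ℕ → (Fin n → ℂ) → EReal,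
        (∀ m, IsPSH Ω (w m)) ∧
        (∀ m, ∃ C : ℝ, ∀ z ∈ Ω, w m z ≤ (C : EReal)) ∧
        (∀ m, ∀ z ∈ Ω, w m z ≤ w (m + 1) z) ∧
        ∀ z ∈ Ω \ E, Tendsto (fun m => w m z) atTop (𝓝 (max (u z) 0)) := by
  let e : ℕ → ℝ := fun m => 1 / ((m : ℝ) + 1)
  have he : ∀ m, 0 < e m := fun m => by positivity
  refine ⟨{z | z ∈ Ω ∧ v z = ⊤}, ⟨fun z hz => hz.1, _, hv, fun z hz => by simp [hz.2]⟩,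
    fun m z => max (u z) 0 + -((e m : EReal) * v z), fun m => ?_, fun m => ?_,
    fun m z hz => ?_, ?_⟩
  · refine hu.max_zero.add (hv.const_mul (he m)) ?_
    obtain ⟨z, hz, hne⟩ := IsPSH.const_mul hv (he m) |>.2.2.1
    exact ⟨z, hz, (EReal.bot_lt_zero.trans_le (le_max_right _ _)).ne', by simpa only [mul_neg] using hne⟩
  · obtain ⟨lam, -, hlam⟩ := h (e m) (he m)
    exact ⟨lam, fun z hz => EReal.sub_le_of_le_add (hlam z hz)⟩
  · have : e (m + 1) ≤ e m := one_div_le_one_div_of_le (by positivity) (by push_cast; linarith)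
    have : (e (m + 1) : EReal) * v z ≤ e m * v z :=
      mul_le_mul_of_nonneg_right (by exact_mod_cast this) (hv0 z hz)
    exact add_le_add le_rfl (EReal.neg_le_neg_iff.2 this)
  · rintro z ⟨hz, hzE⟩
    have hvtop : v z ≠ ⊤ := fun h => hzE ⟨hz, h⟩
    have hvbot : v z ≠ ⊥ := (EReal.bot_lt_zero.trans_le (hv0 z hz)).ne'
    have htop := hu.max_zero.2.1 z hz
    have hbot : max (u z) 0 ≠ ⊥ := (EReal.bot_lt_zero.trans_le (le_max_right _ _)).ne'
    lift v z to ℝ using ⟨hvtop, hvbot⟩ with s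
    lift max (u z) 0 to ℝ using ⟨htop, hbot⟩ with t
    have hlim : Tendsto (fun m => t + -(e m * s)) atTop (𝓝 t) := by
      simpa [e] using ((tendsto_one_div_add_atTop_nhds_zero_nat (𝕜 := ℝ)).mul_const s).neg.const_add t
    exact_mod_cast EReal.tendsto_coe.2 hlim

/-- Theorem 3.2, first part: let `Ω ⊆ ℂⁿ` be a bounded domain and let
`ψ : [-∞, +∞] → [0, +∞]` satisfy `ψ(+∞) = +∞` and `lim_{t→∞} ψ(t)/t = +∞`. If `u` is any
function on `Ω` such that `ψ ∘ u` admits a plurisuperharmonic majorant on `Ω`, then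
`u⁺ = max {u, 0}` is tame. In particular, if `u` is also plurisubharmonic, then `u⁺` is the
limit, outside a pluripolar set, of an increasing sequence of upper bounded
plurisubharmonic functions on `Ω`. -/
theorem statement6 {n : ℕ} (Ω : Set (Fin n → ℂ))
    (hΩo : IsOpen Ω) (hΩc : IsConnected Ω) (hΩb : Bornology.IsBounded Ω)
    (ψ : EReal → EReal) (hψ0 : ∀ t, 0 ≤ ψ t) (hψtop : ψ ⊤ = ⊤)
    (hψgrow : Tendsto (fun t : ℝ => ψ (t : EReal) / (t : EReal)) atTop (nhds (⊤ : EReal)))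
    (u : (Fin n → ℂ) → EReal)
    (hmaj : ∃ v, IsPSupH Ω v ∧ ∀ z ∈ Ω, ψ (u z) ≤ v z) :
    Tame Ω (fun z => max (u z) 0) ∧
    (IsPSH Ω u → ∃ E : Set (Fin n → ℂ), Pluripolar Ω E ∧
      ∃ v : ℕ → (Fin n → ℂ) → EReal,
        (∀ m, IsPSH Ω (v m)) ∧
        (∀ m, ∃ C : ℝ, ∀ z ∈ Ω, v m z ≤ (C : EReal)) ∧
        (∀ m, ∀ z ∈ Ω, v m z ≤ v (m + 1) z) ∧
        ∀ z ∈ Ω \ E, Tendsto (fun m => v m z) atTop (nhds (max (u z) 0))) := by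
  obtain ⟨v, hv, hmaj⟩ := hmaj
  have hv0 : ∀ z ∈ Ω, 0 ≤ v z := fun z hz => (hψ0 _).trans (hmaj z hz)
  have h : ∀ ε : ℝ, 0 < ε → ∃ lam : ℝ, 0 ≤ lam ∧
      ∀ z ∈ Ω, max (u z) 0 ≤ lam + (ε : EReal) * v z := fun ε hε =>
    exists_sub_le_mul_majorant hψ0 hψtop hψgrow hmaj hε
  exact ⟨tame_of_le_add_mul hΩo hΩc.isPreconnected hv hv0 h,
    fun hu => hu.exists_seq_tendsto_max_zero hv hv0 h⟩
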